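/- arXiv:1508.06772 — 3 statements merged into one kernel-verified Lean document; each statement's English description precedes it below -/
import Mathlib

section
/- Let T be a (possibly unbounded) self-adjoint operator on a complex Hilbert space H with bounded transform S = T(I + T²)^{-1/2}. Then σ(T) = { μ(1 - μ²)^{-1/2} : μ ∈ σ(S) ∩ (-1,1) }. -/
noncomputable section

variable {H : Type*} [NormedAddCommGroup H] [InnerProductSpace ℂ H] [CompleteSpace H]

/-- `S = T(I + T²)^{-1/2}`, the *bounded transform* of the (possibly unbounded) operator `T`.
This is witnessed by `C = (I + T²)⁻¹` (a positive bounded operator mapping into the domain of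
`T²` with `(I + T²) ∘ C = I`, which determines `C` uniquely when `T` is self-adjoint) together
with its (unique) positive square root `R = (I + T²)^{-1/2}`, and `S = T ∘ R`. -/
def IsBoundedTransform (T : H →ₗ.[ℂ] H) (S : H →L[ℂ] H) : Prop :=
  ∃ C R : H →L[ℂ] H, C.IsPositive ∧ R.IsPositive ∧ R * R = C ∧
    (∀ x : H, ∃ (h1 : C x ∈ T.domain) (h2 : (T ⟨C x, h1⟩ : H) ∈ T.domain),
        C x + T ⟨(T ⟨C x, h1⟩ : H), h2⟩ = x) ∧
    (∀ x : H, ∃ hx : R x ∈ T.domain, S x = T ⟨R x, hx⟩)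

/-- `S` is a pure contraction: `‖Sx‖ < ‖x‖` for all `x ≠ 0`. -/
def PureContraction (S : H →L[ℂ] H) : Prop := ∀ x : H, x ≠ 0 → ‖S x‖ < ‖x‖

/-- `T = S(I - S²)^{-1/2}`: witnessed by the (unique) positive square root `R` of `I - S²`,
with `D(T) = ran R` and `T ∘ R = S`. -/
def IsInverseBoundedTransform (S : H →L[ℂ] H) (T : H →ₗ.[ℂ] H) : Prop :=
  ∃ R : H →L[ℂ] H, R.IsPositive ∧ R * R = 1 - S * S ∧
    (T.domain : Set H) = Set.range R ∧
    (∀ x : H, ∃ hx : R x ∈ T.domain, (T ⟨R x, hx⟩ : H) = S x)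

/-- The resolvent set of an unbounded operator: `z` such that `T - z` has a (bounded,
everywhere defined) two-sided inverse. -/
def pmapResolventSet (T : H →ₗ.[ℂ] H) : Set ℂ :=
  {z | ∃ B : H →L[ℂ] H,
    (∀ x : H, ∃ h : B x ∈ T.domain, (T ⟨B x, h⟩ : H) - z • B x = x) ∧
    (∀ ψ : T.domain, B ((T ψ : H) - z • (ψ : H)) = ψ)}

/-- The spectrum of an unbounded operator. -/
def pmapSpectrum (T : H →ₗ.[ℂ] H) : Set ℂ := (pmapResolventSet T)ᶜ

/-- The real points of the spectrum of `T` (all of them, if `T` is self-adjoint). -/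
def realSpec (T : H →ₗ.[ℂ] H) : Set ℝ := {x : ℝ | (x : ℂ) ∈ pmapSpectrum T}

/-- `g(S)` for a function `g : ℝ → ℂ`, via the continuous functional calculus of `S`. -/
def boundedCalc (S : H →L[ℂ] H) (g : ℝ → ℂ) : H →L[ℂ] H :=
  cfc (fun z : ℂ => g z.re) S

/-- The homeomorphism `u : (-1,1) → ℝ`, `u(x) = x(1 - x²)^{-1/2}`. -/
def uFun : ℝ → ℝ := fun x => x / Real.sqrt (1 - x ^ 2)

/-- `h ∘ u`, extended by `0` outside `(-1,1)`. -/
def compU (h : ℝ → ℂ) : ℝ → ℂ :=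
  fun x => if x ∈ Set.Ioo (-1 : ℝ) 1 then h (uFun x) else 0

/-- `h(T) := (h ∘ u)(S)`, for a function `h` on `σ(T)`, where `S` is the bounded
transform of `T`. -/
def pmapCalc (S : H →L[ℂ] H) (h : ℝ → ℂ) : H →L[ℂ] H := boundedCalc S (compU h)

/-- `σ̃(S) = σ(S) ∩ (-1,1)`. -/
def tildeSpec (S : H →L[ℂ] H) : Set ℝ := spectrum ℝ S ∩ Set.Ioo (-1) 1

/-- `g ∈ C_c(Ω)`: continuous on `Ω`, vanishing outside a compact subset of `Ω`
(functions on `Ω` are encoded as functions on `ℝ` vanishing identically outside `Ω`). -/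
def MemCc (g : ℝ → ℂ) (Ω : Set ℝ) : Prop :=
  ContinuousOn g Ω ∧ ∃ K : Set ℝ, IsCompact K ∧ K ⊆ Ω ∧ ∀ x ∉ K, g x = 0

/-- `g ∈ C₀(Ω)`: continuous on `Ω` and vanishing at infinity on `Ω`. -/
def MemC0 (g : ℝ → ℂ) (Ω : Set ℝ) : Prop :=
  ContinuousOn g Ω ∧ (∀ x ∉ Ω, g x = 0) ∧
    ∀ ε > 0, ∃ K : Set ℝ, IsCompact K ∧ K ⊆ Ω ∧ ∀ x ∈ Ω \ K, ‖g x‖ < ε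

/-- `g ∈ C_b(Ω)`: continuous and bounded on `Ω`. -/
def MemCb (g : ℝ → ℂ) (Ω : Set ℝ) : Prop :=
  ContinuousOn g Ω ∧ ∃ M : ℝ, ∀ x ∈ Ω, ‖g x‖ ≤ M

/-- The supremum norm `‖f‖_∞` of `f` over `Ω`. -/
def supNorm (f : ℝ → ℂ) (Ω : Set ℝ) : ℝ := sSup ((fun x => ‖f x‖) '' Ω)

/-- The subspace `C*_c(S)H`: the linear span of all `g(S)ψ` with `g ∈ C_c(σ̃(S))`. -/
def ccSpan (S : H →L[ℂ] H) : Submodule ℂ H :=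
  Submodule.span ℂ
    {v : H | ∃ g : ℝ → ℂ, MemCc g (tildeSpec S) ∧ ∃ ψ : H, v = boundedCalc S g ψ}

/-- The subspace `C*₀(S)H`: the linear span of all `g(S)ψ` with `g ∈ C₀(σ̃(S))`. -/
def c0Span (S : H →L[ℂ] H) : Submodule ℂ H :=
  Submodule.span ℂ
    {v : H | ∃ g : ℝ → ℂ, MemC0 g (tildeSpec S) ∧ ∃ ψ : H, v = boundedCalc S g ψ}

/-- `TR ⊂ RT`: the bounded operator `R` commutes with the unbounded operator `T`. -/
def CommutesPMap (T : H →ₗ.[ℂ] H) (R : H →L[ℂ] H) : Prop :=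
  ∀ ψ : T.domain, ∃ h : R (ψ : H) ∈ T.domain, (T ⟨R (ψ : H), h⟩ : H) = R (T ψ)

/-- `A = f₀(T)`: the operator with domain `C*_c(S)H` determined by
`f₀(T) h(T)ψ = (fh)(T)ψ` for `h ∈ C_c(σ(T))` (where `σT` is the spectrum of `T`,
and `h(T) = (h∘u)(S)`). -/
def IsF0 (S : H →L[ℂ] H) (σT : Set ℝ) (f : ℝ → ℂ) (A : H →ₗ.[ℂ] H) : Prop :=
  A.domain = ccSpan S ∧
  ∀ h : ℝ → ℂ, MemCc h σT → ∀ ψ : H,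
    ∃ hm : pmapCalc S h ψ ∈ A.domain,
      A ⟨pmapCalc S h ψ, hm⟩ = pmapCalc S (fun x => f x * h x) ψ

/-- Two elements of the graph of a self-adjoint operator are related by formal symmetry. -/
theorem IsSelfAdjoint.inner_eq_of_mem_graph {T : H →ₗ.[ℂ] H} (hsa : IsSelfAdjoint T)
    {a b c d : H} (hab : (a, b) ∈ T.graph) (hcd : (c, d) ∈ T.graph) :
    inner ℂ b c = inner ℂ a d := by
  have hT : T.IsFormalAdjoint T := by
    have h := LinearPMap.adjoint_isFormalAdjoint hsa.dense_domain
    rwa [LinearPMap.isSelfAdjoint_def.mp hsa] at h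
  obtain ⟨x, rfl, rfl⟩ := (LinearPMap.mem_graph_iff T).mp hab
  obtain ⟨y, rfl, rfl⟩ := (LinearPMap.mem_graph_iff T).mp hcd
  exact hT x y

/-- The bounded transform of a self-adjoint operator is self-adjoint, and together with
`R = (I + T²)^{-1/2}` it parametrizes the graph of `T`. -/
theorem IsBoundedTransform.exists_graph_parametrization {T : H →ₗ.[ℂ] H} {S : H →L[ℂ] H}
    (hbt : IsBoundedTransform T S) (hsa : IsSelfAdjoint T) :
    IsSelfAdjoint S ∧ ∃ R : H →L[ℂ] H, 0 ≤ R ∧ R * R = 1 - S * S ∧ Commute S R ∧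
      Function.Injective R ∧ (∀ x, (R x, S x) ∈ T.graph) ∧
      ∀ a b, (a, b) ∈ T.graph → R b = S a := by
  obtain ⟨C, R, -, hRpos, rfl, hC, hS⟩ := hbt
  have hR0 : 0 ≤ R := (ContinuousLinearMap.nonneg_iff_isPositive R).mpr hRpos
  have hRsa : IsSelfAdjoint R := .of_nonneg hR0
  have graph_C : ∀ x, ∃ y, (R (R x), y) ∈ T.graph ∧ (y, x - R (R x)) ∈ T.graph := by
    intro x
    obtain ⟨h1, h2, h3⟩ := hC x
    refine ⟨_, T.mem_graph ⟨_, h1⟩, ?_⟩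
    rw [← eq_sub_iff_add_eq'] at h3
    exact h3 ▸ T.mem_graph ⟨_, h2⟩
  have graph_S : ∀ x, (R x, S x) ∈ T.graph := by
    intro x
    obtain ⟨h1, h2⟩ := hS x
    exact h2 ▸ T.mem_graph ⟨_, h1⟩
  have uniq : ∀ {a b b' : H}, (a, b) ∈ T.graph → (a, b') ∈ T.graph → b = b' :=
    fun h h' => T.mem_graph_snd_inj h h' rfl
  have C_add : ∀ {a b c : H}, (a, b) ∈ T.graph → (b, c) ∈ T.graph → R (R (a + c)) = a := by
    intro a b c hab hbc
    obtain ⟨y, h1, h2⟩ := graph_C (a + c)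
    have h3 := T.graph.sub_mem h1 hab
    have h4 := T.graph.sub_mem h2 hbc
    rw [Prod.mk_sub_mk] at h3 h4
    have h5 := hsa.inner_eq_of_mem_graph h3 h4
    rw [show a + c - R (R (a + c)) - c = -(R (R (a + c)) - a) by abel, inner_neg_right,
      inner_self_eq_norm_sq_to_K, inner_self_eq_norm_sq_to_K] at h5
    have h6 : ‖y - b‖ ^ 2 = -‖R (R (a + c)) - a‖ ^ 2 := by exact_mod_cast h5
    have h7 : ‖R (R (a + c)) - a‖ = 0 := by
      nlinarith [sq_nonneg ‖y - b‖, sq_nonneg ‖R (R (a + c)) - a‖]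
    exact sub_eq_zero.mp (norm_eq_zero.mp h7)
  have C_graph : ∀ {a b : H}, (a, b) ∈ T.graph → (R (R a), R (R b)) ∈ T.graph := by
    intro a b hab
    obtain ⟨y, h1, h2⟩ := graph_C a
    have h3 := T.graph.sub_mem hab h1
    rw [Prod.mk_sub_mk] at h3
    have h4 := C_add h2 h3
    rw [add_sub_cancel] at h4
    rwa [h4]
  have R_zero : ∀ x, R x = 0 → x = 0 := by
    intro x hx
    obtain ⟨y, h1, h2⟩ := graph_C x
    rw [hx, map_zero] at h1 h2
    rw [sub_zero] at h2
    have hy := uniq h1 T.graph.zero_mem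
    subst hy
    exact uniq h2 T.graph.zero_mem
  have cancel_R : ∀ D : H →L[ℂ] H, D * R = 0 → D = 0 := by
    intro D hD
    have h1 : R * star D = 0 := by
      simpa [hRsa.star_eq] using congrArg star hD
    have h2 : star D = 0 := by
      ext x
      exact R_zero _ (congrArg (fun E : H →L[ℂ] H => E x) h1)
    exact star_eq_zero.mp h2
  have hcomm_C : Commute (R * R) (S * R) := by
    ext x
    exact uniq (C_graph (graph_S (R x))) (graph_S (R (R (R x))))
  have hcomm_A : Commute R (S * R) := by
    have h := hcomm_C.cfc_nnreal NNReal.sqrt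
    rwa [← CFC.sqrt_eq_cfc, CFC.sqrt_mul_self R hR0] at h
  have hSR : S * R = R * S := by
    refine sub_eq_zero.mp (cancel_R _ ?_)
    rw [sub_mul, mul_assoc R, hcomm_A.eq, sub_self]
  have hadj : ∀ {a b : H}, (a, b) ∈ T.graph → R b = star S a := by
    intro a b hab
    refine ext_inner_right ℂ fun y => ?_
    rw [ContinuousLinearMap.star_eq_adjoint, ContinuousLinearMap.adjoint_inner_left,
      ← hsa.inner_eq_of_mem_graph hab (graph_S y)]
    exact hRpos.isSymmetric b y
  have hSsa : star S = S := by
    refine sub_eq_zero.mp (cancel_R _ ?_)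
    rw [sub_mul, hSR, sub_eq_zero]
    ext x
    exact (hadj (graph_S x)).symm
  refine ⟨hSsa, R, hR0, ?_, hSR, ?_, graph_S, fun a b hab => ?_⟩
  · ext x
    obtain ⟨y, h1, h2⟩ := graph_C x
    have h3 : y = R (S x) :=
      (uniq h1 (graph_S (R x))).trans (congrArg (fun E : H →L[ℂ] H => E x) hSR)
    subst h3
    have h4 := uniq h2 (graph_S (S x))
    change R (R x) = x - S (S x)
    rw [← h4, sub_sub_cancel]
  · exact (injective_iff_map_eq_zero R).mpr R_zero
  · rw [hadj hab, hSsa]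

theorem mem_pmapResolventSet_iff_graph {E : Type*} [NormedAddCommGroup E] [InnerProductSpace ℂ E]
    {T : E →ₗ.[ℂ] E} {z : ℂ} :
    z ∈ pmapResolventSet T ↔ ∃ B : E →L[ℂ] E, (∀ x, (B x, x + z • B x) ∈ T.graph) ∧
      ∀ a b, (a, b) ∈ T.graph → B (b - z • a) = a := by
  refine exists_congr fun B => and_congr (forall_congr' fun x => ?_) ⟨fun h a b hab => ?_,
    fun h ψ => h _ _ (T.mem_graph ψ)⟩
  · simp only [LinearPMap.mem_graph_iff, sub_eq_iff_eq_add]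
    exact ⟨fun ⟨h, hx⟩ => ⟨⟨_, h⟩, rfl, hx⟩, fun ⟨⟨_, h⟩, hy, hx⟩ => by subst hy; exact ⟨h, hx⟩⟩
  · obtain ⟨x, rfl, rfl⟩ := (LinearPMap.mem_graph_iff T).mp hab
    exact h x

/-- If `x ↦ (R x, S x)` parametrizes the graph of `T`, then `T - z` is invertible exactly when
`S - z R` is. -/
theorem mem_pmapResolventSet_iff_isUnit {E : Type*} [NormedAddCommGroup E]
    [InnerProductSpace ℂ E] {T : E →ₗ.[ℂ] E} {S R : E →L[ℂ] E}
    (hsq : R * R = 1 - S * S) (hcomm : Commute S R) (hinj : Function.Injective R)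
    (hgraph : ∀ x, (R x, S x) ∈ T.graph) (hswap : ∀ a b, (a, b) ∈ T.graph → R b = S a) (z : ℂ) :
    z ∈ pmapResolventSet T ↔ IsUnit (S - z • R) := by
  have hsq' : ∀ x, R (R x) + S (S x) = x := fun x =>
    congrArg (fun F : E →L[ℂ] E => F x) (eq_sub_iff_add_eq.mp hsq)
  have hcomm' : ∀ x, S (R x) = R (S x) := fun x => congrArg (fun F : E →L[ℂ] E => F x) hcomm.eq
  have hparam : ∀ {a b}, (a, b) ∈ T.graph → R (R a + S b) = a ∧ S (R a + S b) = b := by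
    intro a b hab
    constructor
    · rw [map_add, ← hcomm', hswap a b hab, hsq']
    · rw [map_add, hcomm', ← hswap a b hab, hsq']
  rw [mem_pmapResolventSet_iff_graph]
  constructor
  · rintro ⟨B, hB1, hB2⟩
    set D : E →L[ℂ] E := R * B + S * (1 + z • B)
    have hD : ∀ x, R (D x) = B x ∧ S (D x) = x + z • B x := fun x => hparam (hB1 x)
    refine isUnit_iff_exists.mpr ⟨D, ?_, ?_⟩
    · ext x
      change S (D x) - z • R (D x) = x
      rw [(hD x).1, (hD x).2, add_sub_cancel_right]
    · ext x
      refine hinj ?_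
      change R (D (S x - z • R x)) = R x
      rw [(hD _).1, hB2 _ _ (hgraph x)]
  · intro hu
    obtain ⟨D, hD1, hD2⟩ := isUnit_iff_exists.mp hu
    refine ⟨R * D, fun x => ?_, fun a b hab => ?_⟩
    · have h : S (D x) - z • R (D x) = x := congrArg (fun F : E →L[ℂ] E => F x) hD1
      rw [sub_eq_iff_eq_add] at h
      change (R (D x), x + z • R (D x)) ∈ T.graph
      rw [← h]
      exact hgraph _
    · have h : D (S (R a + S b) - z • R (R a + S b)) = R a + S b :=
        congrArg (fun F : E →L[ℂ] E => F (R a + S b)) hD2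
      rw [(hparam hab).1, (hparam hab).2] at h
      change R (D (b - z • a)) = a
      rw [h, (hparam hab).1]

section CStarAlgebra

variable {A : Type*} [CStarAlgebra A] [PartialOrder A] [StarOrderedRing A] {s r : A}

theorem IsSelfAdjoint.one_sub_sq_nonneg_of_mem_spectrum (hs : IsSelfAdjoint s)
    (hsq : 0 ≤ 1 - s * s) {x : ℝ} (hx : x ∈ spectrum ℝ s) : 0 ≤ 1 - x ^ 2 := by
  have h : cfc (fun x : ℝ => 1 - x ^ 2) s = 1 - s * s := by
    rw [cfc_sub (fun _ : ℝ => (1 : ℝ)) (fun x => x ^ 2) s, cfc_const_one ℝ s,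
      cfc_pow_id s 2, sq]
  rw [← h, cfc_nonneg_iff _ s] at hsq
  exact hsq x hx

theorem IsSelfAdjoint.cfc_sqrt_one_sub_sq (hs : IsSelfAdjoint s) (hr : 0 ≤ r)
    (hsq : r * r = 1 - s * s) : cfc (fun x : ℝ => √(1 - x ^ 2)) s = r := by
  have h0 : 0 ≤ 1 - s * s := hsq ▸ (IsSelfAdjoint.of_nonneg hr).mul_self_nonneg
  have hnonneg : 0 ≤ cfc (fun x : ℝ => √(1 - x ^ 2)) s := cfc_nonneg fun x _ => Real.sqrt_nonneg _
  rw [← CFC.mul_self_eq_mul_self_iff _ r hnonneg hr, hsq, ← cfc_mul _ _ s]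
  rw [cfc_congr fun x hx => Real.mul_self_sqrt (hs.one_sub_sq_nonneg_of_mem_spectrum h0 hx),
    cfc_sub (fun _ : ℝ => (1 : ℝ)) (fun x => x ^ 2) s, cfc_const_one ℝ s, cfc_pow_id s 2, sq]

theorem IsSelfAdjoint.isUnit_sub_smul_iff (hs : IsSelfAdjoint s) (hr : 0 ≤ r)
    (hsq : r * r = 1 - s * s) (z : ℂ) :
    IsUnit (s - z • r) ↔ ∀ x ∈ spectrum ℝ s, (x : ℂ) - z * (√(1 - x ^ 2) : ℝ) ≠ 0 := by
  have hr' : cfc (fun w : ℂ => ((√(1 - w.re ^ 2) : ℝ) : ℂ)) s = r := by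
    rw [← cfc_real_eq_complex (fun x : ℝ => √(1 - x ^ 2)) hs, hs.cfc_sqrt_one_sub_sq hr hsq]
  have hn : IsStarNormal s := hs.isStarNormal
  have h : cfc (fun w : ℂ => w - z * ((√(1 - w.re ^ 2) : ℝ) : ℂ)) s = s - z • r := by
    rw [cfc_sub (fun w : ℂ => w) _ s, cfc_id' ℂ s, cfc_const_mul z _ s, hr']
  rw [← h, isUnit_cfc_iff _ s, ← hs.spectrumRestricts.algebraMap_image]
  simp

end CStarAlgebra

/-- `σ(T) = { μ(1 - μ²)^{-1/2} : μ ∈ σ(S) ∩ (-1,1) }`. -/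
theorem spectrum_eq_image_of_boundedTransform (T : H →ₗ.[ℂ] H) (S : H →L[ℂ] H)
    (hdense : Dense (T.domain : Set H)) (hsa : IsSelfAdjoint T)
    (hbt : IsBoundedTransform T S) :
    pmapSpectrum T =
      (fun μ : ℝ => ((μ / Real.sqrt (1 - μ ^ 2) : ℝ) : ℂ)) ''
        (spectrum ℝ S ∩ Set.Ioo (-1 : ℝ) 1) := by
  obtain ⟨hSsa, R, hR0, hsq, hcomm, hinj, hgraph, hswap⟩ := hbt.exists_graph_parametrization hsa
  ext z
  rw [pmapSpectrum, Set.mem_compl_iff,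
    mem_pmapResolventSet_iff_isUnit hsq hcomm hinj hgraph hswap,
    hSsa.isUnit_sub_smul_iff hR0 hsq]
  push Not
  have h0 : 0 ≤ 1 - S * S := hsq ▸ (IsSelfAdjoint.of_nonneg hR0).mul_self_nonneg
  constructor
  · rintro ⟨x, hx, hzx⟩
    have hle := hSsa.one_sub_sq_nonneg_of_mem_spectrum h0 hx
    have hlt : 0 < 1 - x ^ 2 := by
      refine hle.lt_of_ne fun h => ?_
      rw [← h, Real.sqrt_zero, Complex.ofReal_zero, mul_zero, sub_zero,
        Complex.ofReal_eq_zero] at hzx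
      norm_num [hzx] at h
    refine ⟨x, ⟨hx, abs_lt.mp ((sq_lt_one_iff_abs_lt_one x).mp (by linarith))⟩, ?_⟩
    have hne : ((√(1 - x ^ 2) : ℝ) : ℂ) ≠ 0 :=
      Complex.ofReal_ne_zero.mpr (Real.sqrt_pos.mpr hlt).ne'
    beta_reduce
    rw [Complex.ofReal_div, div_eq_iff hne]
    exact sub_eq_zero.mp hzx
  · rintro ⟨x, ⟨hx, hx1⟩, rfl⟩
    have hlt : 0 < 1 - x ^ 2 := sub_pos.mpr ((sq_lt_one_iff_abs_lt_one x).mpr (abs_lt.mpr hx1))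
    refine ⟨x, hx, ?_⟩
    rw [← Complex.ofReal_mul, div_mul_cancel₀ _ (Real.sqrt_pos.mpr hlt).ne', sub_self]
end
end

section
/- Let T be a densely defined self-adjoint operator on a complex Hilbert space H with bounded transform S = T(I + T²)^{-1/2}, and set σ̃(S) = σ(S) ∩ (-1,1). Then the linear span of all vectors g(S)ψ, where g ranges over the compactly supported continuous functions C_c(σ̃(S)) and ψ over H, is dense in H. (Here g(S) is defined via the continuous functional calculus for the bounded self-adjoint operator S, extending g by 0 outside σ̃(S).) -/
noncomputable section

variable {H : Type*} [NormedAddCommGroup H] [InnerProductSpace ℂ H] [CompleteSpace H]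

open scoped InnerProductSpace

lemma LinearPMap.IsSelfAdjoint.inner_map_comm {T : H →ₗ.[ℂ] H} (hsa : IsSelfAdjoint T)
    (x y : T.domain) : ⟪T x, (y : H)⟫_ℂ = ⟪(x : H), T y⟫_ℂ := by
  have h := T.adjoint_isFormalAdjoint hsa.dense_domain
  rw [LinearPMap.isSelfAdjoint_def.mp hsa] at h
  exact h x y

lemma ContinuousLinearMap.dense_range_of_isSelfAdjoint {A : H →L[ℂ] H} (hA : IsSelfAdjoint A)
    (hinj : ∀ x, A x = 0 → x = 0) : DenseRange A := by
  have h : A.rangeᗮ = ⊥ := by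
    rw [ContinuousLinearMap.orthogonal_range, hA.adjoint_eq, Submodule.eq_bot_iff]
    exact fun x hx => hinj x hx
  have h2 := Submodule.dense_iff_topologicalClosure_eq_top.mpr
    (Submodule.topologicalClosure_eq_top_iff.mpr h)
  exact h2

lemma ContinuousLinearMap.mul_right_cancel_of_denseRange {E : Type*} [NormedAddCommGroup E]
    [InnerProductSpace ℂ E] {A B D : E →L[ℂ] E} (hD : DenseRange D) (h : A * D = B * D) : A = B :=
  ContinuousLinearMap.coeFn_injective <| hD.equalizer A.continuous B.continuous <| by
    ext x
    exact DFunLike.congr_fun h x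

/-- The bounded transform of a self-adjoint operator is self-adjoint, and `I - S²` is a positive
operator with dense range. -/
lemma IsBoundedTransform.isSelfAdjoint_and_isPositive_and_denseRange {T : H →ₗ.[ℂ] H}
    {S : H →L[ℂ] H} (hsa : IsSelfAdjoint T) (hbt : IsBoundedTransform T S) :
    IsSelfAdjoint S ∧ (1 - S * S).IsPositive ∧ DenseRange (1 - S * S : H →L[ℂ] H) := by
  obtain ⟨C, R, hC, hR, hRC, hT, hS⟩ := hbt
  have hsym := LinearPMap.IsSelfAdjoint.inner_map_comm hsa
  have hRR (x : H) : R (R x) = C x := DFunLike.congr_fun hRC x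
  have hCinj (x : H) (hx : C x = 0) : x = 0 := by
    obtain ⟨h1, h2, h⟩ := hT x
    have e : (⟨C x, h1⟩ : T.domain) = 0 := Subtype.ext hx
    have e2 : (⟨T ⟨C x, h1⟩, h2⟩ : T.domain) = 0 := Subtype.ext (by simp [e])
    rw [e2, T.map_zero, hx, add_zero] at h
    exact h.symm
  have hRinj (x : H) (hx : R x = 0) : x = 0 := hCinj x (by rw [← hRR, hx, map_zero])
  have hRdense := ContinuousLinearMap.dense_range_of_isSelfAdjoint hR.isSelfAdjoint hRinj
  have hCdense := ContinuousLinearMap.dense_range_of_isSelfAdjoint hC.isSelfAdjoint hCinj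
  have hRsym (x y : H) : ⟪R x, y⟫_ℂ = ⟪x, R y⟫_ℂ := hR.isSymmetric x y
  have hCsym (x y : H) : ⟪C x, y⟫_ℂ = ⟪x, C y⟫_ℂ := hC.isSymmetric x y
  set B : H →L[ℂ] H := S * R with hB
  have hTC (x : H) (h1 : C x ∈ T.domain) : T ⟨C x, h1⟩ = B x := by
    obtain ⟨h, e⟩ := hS (R x)
    change _ = S (R x)
    rw [e]
    congr 2
    exact (hRR x).symm
  have hCd (x : H) : C x ∈ T.domain := (hT x).1
  have hBd (x : H) : B x ∈ T.domain := by
    obtain ⟨h1, h2, -⟩ := hT x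
    rwa [hTC] at h2
  have hTB (x : H) : T ⟨B x, hBd x⟩ = x - C x := by
    obtain ⟨h1, h2, h⟩ := hT x
    have e : (⟨B x, hBd x⟩ : T.domain) = ⟨T ⟨C x, h1⟩, h2⟩ := Subtype.ext (hTC x h1).symm
    rw [eq_sub_iff_add_eq', e, h]
  have hBsym (x y : H) : ⟪B x, y⟫_ℂ = ⟪x, B y⟫_ℂ := by
    have e1 := hsym ⟨C x, hCd x⟩ ⟨C y, hCd y⟩
    have e2 := hsym ⟨B x, hBd x⟩ ⟨B y, hBd y⟩
    rw [hTC, hTC] at e1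
    rw [hTB, hTB] at e2
    simp only [inner_sub_left, inner_sub_right] at e1 e2
    linear_combination e1 - e2
  have hCT (ψ : T.domain) : C (T ψ) = B ψ := by
    refine ext_inner_right ℂ fun y => ?_
    rw [hCsym, hBsym, ← hTC y (hCd y)]
    exact hsym ψ ⟨C y, hCd y⟩
  have hBC : Commute B C := by
    ext x
    change B (C x) = C (B x)
    rw [← hTC x (hCd x), hCT]
  have hBR : Commute B R := by
    have e : CFC.sqrt C = R :=
      CFC.sqrt_unique hRC ((ContinuousLinearMap.nonneg_iff_isPositive R).mpr hR)
    rw [← e]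
    exact (hBC.symm.cfcₙ_nnreal _).symm
  have hSR : S * R = R * S := by
    refine ContinuousLinearMap.mul_right_cancel_of_denseRange hRdense ?_
    rw [mul_assoc R]
    exact hBR
  have hSself : IsSelfAdjoint S := by
    rw [ContinuousLinearMap.isSelfAdjoint_iff_isSymmetric]
    intro x y
    change ⟪S x, y⟫_ℂ = ⟪x, S y⟫_ℂ
    induction y using hRdense.induction_on with
    | hp => exact isClosed_eq (by fun_prop) (by fun_prop)
    | ih y =>
      have e : R (S x) = B x := (DFunLike.congr_fun hSR x).symm
      rw [← hRsym, e, hBsym]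
      rfl
  have hSC : 1 - S * S = C := by
    refine ContinuousLinearMap.mul_right_cancel_of_denseRange hCdense ?_
    have e : S * S * C = B * B := by
      simp only [hB, ← hRC, mul_assoc]
      rw [← mul_assoc R S R, ← hSR, mul_assoc]
    ext x
    have e1 : S (S (C x)) = B (B x) := DFunLike.congr_fun e x
    have e2 : B (B x) = C (x - C x) := by
      rw [← hTB, hCT]
    change C x - S (S (C x)) = C (C x)
    rw [e1, e2, map_sub, sub_sub_cancel]
  rw [hSC]
  exact ⟨hSself, hC, hCdense⟩

lemma ContinuousLinearMap.norm_le_one_of_isPositive_one_sub {S : H →L[ℂ] H}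
    (hS : IsSelfAdjoint S) (h : (1 - S * S).IsPositive) : ‖S‖ ≤ 1 := by
  refine S.opNorm_le_bound zero_le_one fun x => ?_
  have h1 := h.re_inner_nonneg_right x
  have h2 : ⟪x, S (S x)⟫_ℂ = ⟪S x, S x⟫_ℂ := (hS.isSymmetric x (S x)).symm
  have h3 : (1 - S * S : H →L[ℂ] H) x = x - S (S x) := rfl
  rw [h3, inner_sub_right, h2, map_sub, inner_self_eq_norm_sq, inner_self_eq_norm_sq] at h1
  rw [one_mul]
  exact le_of_sq_le_sq (by linarith) (norm_nonneg x)

/-- The truncation `max(1 - x² - ε, 0)` of `1 - x²` is compactly supported in `σ̃(S)`. -/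
lemma memCc_truncation (S : H →L[ℂ] H) {ε : ℝ} (hε : 0 < ε) :
    MemCc ((spectrum ℝ S).indicator fun x => ((max (1 - x ^ 2 - ε) 0 : ℝ) : ℂ))
      (tildeSpec S) := by
  refine ⟨?_, spectrum ℝ S ∩ {x | ε ≤ 1 - x ^ 2}, ?_, ?_, ?_⟩
  · have h : Continuous fun x : ℝ => ((max (1 - x ^ 2 - ε) 0 : ℝ) : ℂ) := by fun_prop
    exact h.continuousOn.congr fun x hx => Set.indicator_of_mem hx.1 _
  · exact (spectrum.isCompact S).inter_right (isClosed_le (by fun_prop) (by fun_prop))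
  · rintro x ⟨hx, hx'⟩
    rw [Set.mem_ofPred_eq] at hx'
    exact ⟨hx, by constructor <;> nlinarith⟩
  · intro x hx
    by_cases hxS : x ∈ spectrum ℝ S
    · have : ¬ ε ≤ 1 - x ^ 2 := fun h => hx ⟨hxS, h⟩
      rw [Set.indicator_of_mem hxS, max_eq_right (by linarith), Complex.ofReal_zero]
    · exact Set.indicator_of_notMem hxS _

lemma norm_one_sub_sq_sub_boundedCalc_truncation_le {S : H →L[ℂ] H} (hS : IsSelfAdjoint S)
    (hS1 : ‖S‖ ≤ 1) {ε : ℝ} (hε : 0 < ε) :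
    ‖(1 - S * S) - boundedCalc S
      ((spectrum ℝ S).indicator fun x => ((max (1 - x ^ 2 - ε) 0 : ℝ) : ℂ))‖ ≤ ε := by
  have hnormal : IsStarNormal S := hS.isStarNormal
  have hre (z : ℂ) (hz : z ∈ spectrum ℂ S) : (z.re : ℂ) = z ∧ z.re ∈ spectrum ℝ S := by
    have h := hS.mem_spectrum_eq_re hz
    refine ⟨h.symm, ?_⟩
    rw [h] at hz
    exact hz
  have h1 : 1 - S * S = cfc (fun z : ℂ => 1 - z * z) S := by
    rw [cfc_sub (fun _ : ℂ => 1) (fun z : ℂ => z * z) S, cfc_const_one ℂ S,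
      cfc_mul (fun z : ℂ => z) (fun z : ℂ => z) S, cfc_id' ℂ S]
  have h2 : boundedCalc S
      ((spectrum ℝ S).indicator fun x => ((max (1 - x ^ 2 - ε) 0 : ℝ) : ℂ)) =
      cfc (fun z : ℂ => ((max (1 - z.re ^ 2 - ε) 0 : ℝ) : ℂ)) S :=
    cfc_congr fun z hz => Set.indicator_of_mem (hre z hz).2 _
  rw [h1, h2, ← cfc_sub (fun z : ℂ => 1 - z * z)
    (fun z : ℂ => ((max (1 - z.re ^ 2 - ε) 0 : ℝ) : ℂ)) S]
  refine norm_cfc_le hε.le fun z hz => ?_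
  have hz1 : ‖z‖ ≤ 1 := (spectrum.norm_le_norm_mul_of_mem hz).trans <| by
    nlinarith [norm_nonneg S, ContinuousLinearMap.norm_id_le (𝕜 := ℂ) (E := H),
      show ‖(1 : H →L[ℂ] H)‖ = ‖ContinuousLinearMap.id ℂ H‖ from rfl]
  have hzr := (hre z hz).1
  generalize z.re = x at hzr
  subst hzr
  rw [Complex.norm_real, Real.norm_eq_abs, abs_le] at hz1
  norm_cast
  rw [Real.norm_eq_abs, abs_le]
  constructor <;> rcases max_cases (1 - x ^ 2 - ε) 0 with ⟨h, h'⟩ | ⟨h, h'⟩ <;>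
    rw [h] <;> nlinarith

/-- The linear span `C*_c(S)H` of all vectors `g(S)ψ`, with `g ∈ C_c(σ̃(S))` and `ψ ∈ H`,
is dense in `H`. -/
theorem ccSpan_dense (T : H →ₗ.[ℂ] H) (S : H →L[ℂ] H)
    (hdense : Dense (T.domain : Set H)) (hsa : IsSelfAdjoint T)
    (hbt : IsBoundedTransform T S) :
    Dense ((ccSpan S : Submodule ℂ H) : Set H) := by
  obtain ⟨hS, hpos, hrange⟩ :=
    IsBoundedTransform.isSelfAdjoint_and_isPositive_and_denseRange hsa hbt
  have hS1 := ContinuousLinearMap.norm_le_one_of_isPositive_one_sub hS hpos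
  refine dense_closure.mp (hrange.mono ?_)
  rintro _ ⟨ψ, rfl⟩
  rw [Metric.mem_closure_iff]
  intro δ hδ
  have hψ : 0 < ‖ψ‖ + 1 := by positivity
  have hε : 0 < δ / (‖ψ‖ + 1) := by positivity
  refine ⟨_, Submodule.subset_span ⟨_, memCc_truncation S hε, ψ, rfl⟩, ?_⟩
  rw [dist_eq_norm, ← sub_apply]
  refine (ContinuousLinearMap.le_of_opNorm_le _
    (norm_one_sub_sq_sub_boundedCalc_truncation_le hS hS1 hε) ψ).trans_lt ?_
  rw [div_mul_eq_mul_div, div_lt_iff₀ hψ]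
  nlinarith
end
end

section
/- Let T be a densely defined self-adjoint operator on a complex Hilbert space H with bounded transform S, σ̃(S) = σ(S) ∩ (-1,1), and u(x) = x(1 - x²)^{-1/2}. For h ∈ C₀(σ(T)) set h(T) = (h∘u)(S) via the functional calculus for S. For f ∈ C_b(σ(T)), the operator f₀(T) defined on the dense domain C*₀(S)H (the linear span of vectors g(S)ψ with g ∈ C₀(σ̃(S)), ψ ∈ H) by linear extension of f₀(T) h(T)ψ = (fh)(T)ψ is well defined and bounded, with ‖f₀(T)‖ ≤ ‖f‖_∞. -/
noncomputable section

variable {H : Type*} [NormedAddCommGroup H] [InnerProductSpace ℂ H] [CompleteSpace H]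

open scoped InnerProductSpace Topology
open Filter

/-- The algebraic content of the bounded transform of a self-adjoint operator `T`: with
`R = (I + T²)^{-1/2}`, the operator `S = T R` is self-adjoint, `S² = I - R²`, and `R` is
positive and injective. -/
lemma IsBoundedTransform.exists_sqrt {T : H →ₗ.[ℂ] H} {S : H →L[ℂ] H}
    (hdense : Dense (T.domain : Set H)) (hsa : IsSelfAdjoint T) (hbt : IsBoundedTransform T S) :
    IsSelfAdjoint S ∧ ∃ R : H →L[ℂ] H, R.IsPositive ∧ (∀ x, R x = 0 → x = 0) ∧
      S * S = 1 - R * R ∧ ∀ x, (R x, S x) ∈ T.graph := by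
  obtain ⟨C, R, -, hR, hRC, hT2, hTR⟩ := hbt
  have hRC' : ∀ x, R (R x) = C x := fun x => by rw [← hRC]; rfl
  have hgraph : ∀ x, (R x, S x) ∈ T.graph := fun x => by
    obtain ⟨hx, h⟩ := hTR x
    exact LinearPMap.mem_graph_iff' _ |>.2 ⟨⟨R x, hx⟩, by rw [h]⟩
  have hCG : ∀ x, ∃ w, (C x, w) ∈ T.graph ∧ (w, x - C x) ∈ T.graph := fun x => by
    obtain ⟨h1, h2, h⟩ := hT2 x
    refine ⟨T ⟨C x, h1⟩, T.mem_graph ⟨C x, h1⟩, ?_⟩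
    have := T.mem_graph ⟨_, h2⟩
    rwa [← eq_sub_of_add_eq' h]
  have hsymm : ∀ {a a' b b' : H}, (a, a') ∈ T.graph → (b, b') ∈ T.graph →
      ⟪a', b⟫_ℂ = ⟪a, b'⟫_ℂ := by
    intro a a' b b' ha hb
    obtain ⟨x, hx⟩ := (LinearPMap.mem_graph_iff' _).1 ha
    obtain ⟨y, hy⟩ := (LinearPMap.mem_graph_iff' _).1 hb
    have hF := LinearPMap.adjoint_isFormalAdjoint (T := T) hdense
    rw [LinearPMap.isSelfAdjoint_def.1 hsa] at hF
    have := hF x y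
    simp only [Prod.mk.injEq] at hx hy
    rwa [hx.1, hx.2, hy.1, hy.2] at this
  have huniq : ∀ {a b c : H}, (a, b) ∈ T.graph → (a, c) ∈ T.graph → b = c :=
    fun h h' => LinearPMap.mem_graph_snd_inj _ h h' rfl
  have hker : ∀ {a b : H}, (a, b) ∈ T.graph → (b, -a) ∈ T.graph → a = 0 := by
    intro a b h h'
    have h1 := hsymm h h'
    rw [inner_neg_right, inner_self_eq_norm_sq_to_K, inner_self_eq_norm_sq_to_K] at h1
    have h2 : ‖b‖ ^ 2 = -‖a‖ ^ 2 := by exact_mod_cast h1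
    have h3 : ‖a‖ = 0 := by nlinarith [sq_nonneg ‖a‖, sq_nonneg ‖b‖]
    simpa using h3
  have hCinj : ∀ x, C x = 0 → x = 0 := by
    intro x hx
    obtain ⟨w, h1, h2⟩ := hCG x
    rw [hx] at h1 h2
    have hw : w = 0 := huniq h1 T.graph.zero_mem
    rw [hw, sub_zero] at h2
    exact huniq h2 T.graph.zero_mem
  have hRinj : ∀ x, R x = 0 → x = 0 := fun x hx => hCinj x (by rw [← hRC', hx, map_zero])
  have hCT : ∀ {p q : H}, (p, q) ∈ T.graph → (C p, C q) ∈ T.graph := by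
    intro p q h
    obtain ⟨w, h1, h2⟩ := hCG p
    obtain ⟨w', h1', h2'⟩ := hCG q
    have h3 := T.graph.sub_mem (T.graph.sub_mem h h1) h2'
    have h4 := T.graph.sub_mem h2 h1'
    have h5 : w - C q = 0 := by
      refine hker h4 ?_
      convert h3 using 1
      ext <;> simp
    rwa [← sub_eq_zero.1 h5]
  have hSC : Commute S C := by
    ext x
    have h1 := hCT (hgraph x)
    have h2 := hgraph (C x)
    rw [← hRC' (R x), hRC' x] at h1
    exact huniq h2 h1
  have hSR : Commute S R := by
    have hR0 : 0 ≤ R := (ContinuousLinearMap.nonneg_iff_isPositive R).2 hR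
    rw [← CFC.sqrt_unique hRC hR0, CFC.sqrt_eq_cfc]
    exact (hSC.symm.cfc_nnreal _).symm
  have hSR' : ∀ x, S (R x) = R (S x) := fun x => congrArg (fun A : H →L[ℂ] H => A x) hSR.eq
  have hSC' : ∀ x, S (C x) = C (S x) := fun x => congrArg (fun A : H →L[ℂ] H => A x) hSC.eq
  have hRs : ∀ x y, ⟪R x, y⟫_ℂ = ⟪x, R y⟫_ℂ := fun x y => hR.isSymmetric x y
  refine ⟨?_, R, hR, hRinj, ?_, hgraph⟩
  · rw [ContinuousLinearMap.isSelfAdjoint_iff']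
    ext x
    rw [← sub_eq_zero]
    refine hRinj _ ?_
    rw [map_sub, sub_eq_zero]
    refine ext_inner_right ℂ fun y => ?_
    rw [hRs, ContinuousLinearMap.adjoint_inner_left, hSR', ← hRs, ← hsymm (hgraph x) (hgraph y),
      hRs]
  · ext x
    have h1 := hgraph (R x)
    rw [hRC'] at h1
    obtain ⟨w, h2, h3⟩ := hCG x
    obtain rfl := huniq h1 h2
    have h4 := hgraph (R (S (R x)))
    rw [hRC'] at h4
    have h5 := huniq h4 (hCT h3)
    rw [← sub_eq_zero]
    refine hCinj _ ?_
    rw [map_sub, sub_eq_zero]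
    simp only [mul_apply_eq_comp, sub_apply, one_apply_eq_self, hRC']
    rw [← h5, hSR' x, hRC', hSC']

/-- A point `x ∈ (-1, 1)` of the spectrum of the bounded transform of `T` is sent by `u` into
the spectrum of `T`. -/
lemma uFun_mem_realSpec {T : H →ₗ.[ℂ] H} {S R : H →L[ℂ] H} (hS : IsSelfAdjoint S)
    (hR : R.IsPositive) (hSR : S * S = 1 - R * R) (hgraph : ∀ x, (R x, S x) ∈ T.graph)
    {x : ℝ} (hx : x ∈ tildeSpec S) : uFun x ∈ realSpec T := by
  obtain ⟨hxS, hx1⟩ := hx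
  by_contra hcon
  have hres : ((uFun x : ℝ) : ℂ) ∈ pmapResolventSet T := by
    simpa [realSpec, pmapSpectrum] using hcon
  obtain ⟨B, -, hB⟩ := hres
  set l : ℝ := uFun x with hl
  set c : ℝ := Real.sqrt (1 - x ^ 2) with hc
  have hpos : 0 < 1 - x ^ 2 := by nlinarith [hx1.1, hx1.2]
  have hc0 : 0 < c := Real.sqrt_pos.2 hpos
  have hc2 : c * c = 1 - x ^ 2 := Real.mul_self_sqrt hpos.le
  have hlc : l * c = x := by rw [hl, uFun, div_mul_cancel₀]; exact hc0.ne'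
  have hR0 : 0 ≤ R := (ContinuousLinearMap.nonneg_iff_isPositive R).2 hR
  let a : ℝ → (H →L[ℂ] H) := algebraMap ℝ (H →L[ℂ] H)
  have hunit : IsUnit (R + a c) := by
    have : -c ∉ spectrum ℝ R := fun h => by
      have := spectrum_nonneg_of_nonneg hR0 h
      linarith
    rw [spectrum.notMem_iff] at this
    have h2 := this.neg
    have h3 : -(algebraMap ℝ (H →L[ℂ] H) (-c) - R) = R + a c := by
      simp only [a, map_neg]; abel
    rwa [h3] at h2
  obtain ⟨U, hU⟩ := hunit
  have hBR : B * (S - a l * R) = R := by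
    ext y
    obtain ⟨z, hz⟩ := (LinearPMap.mem_graph_iff' _).1 (hgraph y)
    simp only [Prod.mk.injEq] at hz
    have h := hB z
    rw [hz.1, hz.2] at h
    simpa [a, Algebra.algebraMap_eq_smul_one] using h
  have hac : ∀ (r : ℝ) (A : H →L[ℂ] H), a r * A = A * a r := fun r A => Algebra.commutes r A
  have hxx : (S + a x) * (S - a x) = -((R + a c) * (R - a c)) := by
    have e1 : (S + a x) * (S - a x) = S * S - a (x ^ 2) := by
      simp only [a, map_pow]
      linear_combination (norm := noncomm_ring) hac x S
    have e2 : (R + a c) * (R - a c) = R * R - a (c * c) := by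
      simp only [a, map_mul]
      linear_combination (norm := noncomm_ring) hac c R
    rw [e1, e2, hc2, hSR]
    simp only [a, map_sub, map_one]
    abel
  let E : H →L[ℂ] H := -((U⁻¹ : (H →L[ℂ] H)ˣ) : H →L[ℂ] H) * (S + a x)
  have hE : E * (S - a x) = R - a c := by
    simp only [E]
    rw [mul_assoc, hxx, ← hU, neg_mul_neg, Units.inv_mul_cancel_left]
  have hD : B * (1 - a l * E) * (S - a x) = R := by
    have : a l * a c = a x := by rw [← hlc]; exact (map_mul (algebraMap ℝ (H →L[ℂ] H)) l c).symm
    rw [mul_assoc, sub_mul, mul_assoc, hE, one_mul, mul_sub (a l), this,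
      show S - a x - (a l * R - a x) = S - a l * R by abel, hBR]
  have hL : (a c⁻¹ * (B * (1 - a l * E) - E)) * (S - a x) = 1 := by
    rw [mul_assoc, sub_mul, hD, hE, sub_sub_cancel]
    simp only [a, ← map_mul]
    rw [inv_mul_cancel₀ hc0.ne', map_one]
  have hsa : IsSelfAdjoint (S - a x) := hS.sub (IsSelfAdjoint.algebraMap _ (IsSelfAdjoint.all x))
  have hL' := congrArg star hL
  rw [star_mul, hsa.star_eq, star_one] at hL'
  have hu : IsUnit (S - a x) := isUnit_iff_exists_and_exists.2 ⟨⟨_, hL'⟩, ⟨_, hL⟩⟩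
  refine spectrum.mem_iff.1 hxS ?_
  have := hu.neg
  rwa [neg_sub] at this

/-- `g` is continuous on `σ ∩ (-1, 1)` and tends to `0` as `x ∈ σ` approaches `±1`. -/
def VanishesAtEnds (σ : Set ℝ) (g : ℝ → ℂ) : Prop :=
  ContinuousOn g (σ ∩ Set.Ioo (-1) 1) ∧
    ∀ ε > 0, ∃ δ > 0, ∀ x ∈ σ, 1 - x ^ 2 < δ → ‖g x‖ < ε

lemma one_sub_sq_pos_iff {x : ℝ} : 0 < 1 - x ^ 2 ↔ x ∈ Set.Ioo (-1 : ℝ) 1 := by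
  rw [sub_pos, sq_lt_one_iff_abs_lt_one, abs_lt, Set.mem_Ioo]

lemma VanishesAtEnds.continuousOn {σ : Set ℝ} {g : ℝ → ℂ} (hg : VanishesAtEnds σ g) :
    ContinuousOn g σ := by
  intro x hx
  by_cases hx1 : x ∈ Set.Ioo (-1 : ℝ) 1
  · refine (hg.1 x ⟨hx, hx1⟩).mono_of_mem_nhdsWithin ?_
    exact inter_mem_nhdsWithin σ (isOpen_Ioo.mem_nhds hx1)
  · have hle : 1 - x ^ 2 ≤ 0 := not_lt.1 fun h => hx1 (one_sub_sq_pos_iff.1 h)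
    have h0 : g x = 0 := by
      by_contra h
      obtain ⟨δ, hδ, H⟩ := hg.2 ‖g x‖ (norm_pos_iff.2 h)
      exact lt_irrefl _ (H x hx (by linarith))
    rw [ContinuousWithinAt, h0, Metric.tendsto_nhds]
    intro ε hε
    obtain ⟨δ, hδ, H⟩ := hg.2 ε hε
    have hc : Continuous fun y : ℝ => 1 - y ^ 2 := by fun_prop
    have hev : ∀ᶠ y in 𝓝[σ] x, 1 - y ^ 2 < δ :=
      nhdsWithin_le_nhds (hc.continuousAt.eventually_lt continuousAt_const (by linarith))
    filter_upwards [hev, self_mem_nhdsWithin] with y hy hyσ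
    rw [dist_zero_right]
    exact H y hyσ hy

lemma VanishesAtEnds.bounded_mul {σ : Set ℝ} {g φ : ℝ → ℂ} {M : ℝ} (hg : VanishesAtEnds σ g)
    (hφ : ContinuousOn φ (σ ∩ Set.Ioo (-1) 1)) (hM : ∀ x ∈ σ, ‖φ x‖ ≤ M) :
    VanishesAtEnds σ fun x => φ x * g x := by
  refine ⟨hφ.mul hg.1, fun ε hε => ?_⟩
  obtain ⟨δ, hδ, H⟩ := hg.2 (ε / (|M| + 1)) (by positivity)
  refine ⟨δ, hδ, fun x hx hxδ => ?_⟩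
  have h1 := H x hx hxδ
  rw [lt_div_iff₀ (by positivity)] at h1
  rw [norm_mul]
  nlinarith [norm_nonneg (g x), norm_nonneg (φ x), hM x hx, le_abs_self M]

lemma MemC0.vanishesAtEnds {σ : Set ℝ} {g : ℝ → ℂ}
    (hg : MemC0 g (σ ∩ Set.Ioo (-1) 1)) : VanishesAtEnds σ g := by
  refine ⟨hg.1, fun ε hε => ?_⟩
  obtain ⟨K, hK, hKs, H⟩ := hg.2.2 ε hε
  have hδ : ∃ δ > 0, ∀ x ∈ K, δ ≤ 1 - x ^ 2 := by
    rcases K.eq_empty_or_nonempty with rfl | hne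
    · exact ⟨1, one_pos, by simp⟩
    · have hc : ContinuousOn (fun y : ℝ => 1 - y ^ 2) K := by fun_prop
      obtain ⟨x, hx, hmin⟩ := hK.exists_isMinOn hne hc
      exact ⟨1 - x ^ 2, one_sub_sq_pos_iff.2 (hKs hx).2, fun y hy => hmin hy⟩
  obtain ⟨δ, hδ, hKδ⟩ := hδ
  refine ⟨δ, hδ, fun x _ hxδ => ?_⟩
  by_cases hxΩ : x ∈ σ ∩ Set.Ioo (-1) 1
  · exact H x ⟨hxΩ, fun hxK => absurd (hKδ x hxK) (not_le.2 hxδ)⟩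
  · rwa [hg.2.1 x hxΩ, norm_zero]

lemma continuousOn_uFun : ContinuousOn uFun (Set.Ioo (-1) 1) := by
  refine ContinuousOn.div continuousOn_id (by fun_prop) fun x hx => ?_
  exact (Real.sqrt_pos.2 (one_sub_sq_pos_iff.2 hx)).ne'

lemma continuousOn_compU {σ Ω : Set ℝ} {f : ℝ → ℂ} (hf : ContinuousOn f Ω)
    (hu : Set.MapsTo uFun (σ ∩ Set.Ioo (-1) 1) Ω) :
    ContinuousOn (compU f) (σ ∩ Set.Ioo (-1) 1) :=
  (hf.comp (continuousOn_uFun.mono Set.inter_subset_right) hu).congr fun x hx => by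
    simp [compU, hx.2.1, hx.2.2]

lemma MemC0.vanishesAtEnds_compU {σ Ω : Set ℝ} {h : ℝ → ℂ} (hh : MemC0 h Ω)
    (hu : Set.MapsTo uFun (σ ∩ Set.Ioo (-1) 1) Ω) : VanishesAtEnds σ (compU h) := by
  refine ⟨continuousOn_compU hh.1 hu, fun ε hε => ?_⟩
  obtain ⟨K, hK, hKs, H⟩ := hh.2.2 ε hε
  obtain ⟨r, hr⟩ := hK.isBounded.exists_norm_le
  refine ⟨1 / (1 + r ^ 2), by positivity, fun x hxσ hxδ => ?_⟩
  by_cases hx : x ∈ Set.Ioo (-1 : ℝ) 1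
  · have hpos := one_sub_sq_pos_iff.2 hx
    rw [compU, if_pos hx]
    refine H _ ⟨hu ⟨hxσ, hx⟩, fun hxK => ?_⟩
    have h1 := hr _ hxK
    have h2 : uFun x ^ 2 ≤ r ^ 2 := sq_le_sq' (abs_le.1 h1).1 (abs_le.1 h1).2
    rw [uFun, div_pow, Real.sq_sqrt hpos.le, div_le_iff₀ hpos] at h2
    rw [lt_div_iff₀ (by positivity)] at hxδ
    nlinarith
  · rwa [compU, if_neg hx, norm_zero]

/-- A continuous cutoff function on `ℝ`, vanishing off `(-1, 1)` and equal to `1` where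
`n (1 - x²) ≥ 1`. -/
def endCutoff (n : ℕ) (x : ℝ) : ℝ := min 1 (n * max 0 (1 - x ^ 2))

lemma endCutoff_nonneg (n : ℕ) (x : ℝ) : 0 ≤ endCutoff n x :=
  le_min zero_le_one (by positivity)

lemma endCutoff_le_one (n : ℕ) (x : ℝ) : endCutoff n x ≤ 1 := min_le_left _ _

lemma norm_endCutoff (n : ℕ) (x : ℝ) : ‖(endCutoff n x : ℂ)‖ = endCutoff n x := by
  rw [Complex.norm_real, Real.norm_of_nonneg (endCutoff_nonneg n x)]

lemma vanishesAtEnds_endCutoff (σ : Set ℝ) (n : ℕ) :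
    VanishesAtEnds σ fun x => (endCutoff n x : ℂ) := by
  refine ⟨by unfold endCutoff; fun_prop, fun ε hε => ⟨ε / (n + 1), by positivity, ?_⟩⟩
  intro x _ hx
  rw [norm_endCutoff]
  rw [lt_div_iff₀ (by positivity)] at hx
  refine (min_le_right _ _).trans_lt ?_
  rcases le_total (1 - x ^ 2) 0 with h | h
  · rwa [max_eq_left h, mul_zero]
  · rw [max_eq_right h]
    linarith

lemma re_mem_spectrum {S : H →L[ℂ] H} (hS : IsSelfAdjoint S) {z : ℂ} (hz : z ∈ spectrum ℂ S) :
    z.re ∈ spectrum ℝ S := by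
  rw [hS.mem_spectrum_eq_re hz] at hz
  exact (spectrum.algebraMap_mem_iff ℂ).1 hz

lemma ContinuousOn.comp_re_spectrum {S : H →L[ℂ] H} (hS : IsSelfAdjoint S) {g : ℝ → ℂ}
    (hg : ContinuousOn g (spectrum ℝ S)) :
    ContinuousOn (fun z : ℂ => g z.re) (spectrum ℂ S) :=
  hg.comp Complex.continuous_re.continuousOn fun _ hz => re_mem_spectrum hS hz

lemma norm_boundedCalc_le {S : H →L[ℂ] H} (hS : IsSelfAdjoint S) {g : ℝ → ℂ} {M : ℝ}
    (hM : 0 ≤ M) (h : ∀ x ∈ spectrum ℝ S, ‖g x‖ ≤ M) : ‖boundedCalc S g‖ ≤ M :=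
  norm_cfc_le hM fun _ hz => h _ (re_mem_spectrum hS hz)

lemma boundedCalc_mul {S : H →L[ℂ] H} (hS : IsSelfAdjoint S) {g k : ℝ → ℂ}
    (hg : ContinuousOn g (spectrum ℝ S)) (hk : ContinuousOn k (spectrum ℝ S)) :
    boundedCalc S (fun x => g x * k x) = boundedCalc S g * boundedCalc S k :=
  cfc_mul _ _ S (hg.comp_re_spectrum hS) (hk.comp_re_spectrum hS)

lemma boundedCalc_sub {S : H →L[ℂ] H} (hS : IsSelfAdjoint S) {g k : ℝ → ℂ}
    (hg : ContinuousOn g (spectrum ℝ S)) (hk : ContinuousOn k (spectrum ℝ S)) :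
    boundedCalc S (fun x => g x - k x) = boundedCalc S g - boundedCalc S k :=
  cfc_sub (fun z : ℂ => g z.re) (fun z : ℂ => k z.re) S
    (hg.comp_re_spectrum hS) (hk.comp_re_spectrum hS)

/-- For `φ` bounded and continuous on `σ̃(S)` and `g` vanishing at the ends, the operators
`(φ eₙ)(S) g(S)`, with `eₙ` the cutoff functions, converge to `(φ g)(S)`. -/
lemma tendsto_boundedCalc_endCutoff {S : H →L[ℂ] H} (hS : IsSelfAdjoint S) {φ g : ℝ → ℂ}
    {M : ℝ} (hφ : ContinuousOn φ (tildeSpec S)) (hM : ∀ x ∈ spectrum ℝ S, ‖φ x‖ ≤ M)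
    (hg : VanishesAtEnds (spectrum ℝ S) g) :
    Tendsto (fun n : ℕ => boundedCalc S (fun x => φ x * endCutoff n x) * boundedCalc S g) atTop
      (𝓝 (boundedCalc S fun x => φ x * g x)) := by
  rw [Metric.tendsto_atTop]
  intro ε hε
  have hφg := hg.bounded_mul hφ hM
  obtain ⟨δ, hδ, H⟩ := hφg.2 (ε / 2) (by positivity)
  obtain ⟨N, hN⟩ := exists_nat_ge (1 / δ)
  refine ⟨N, fun n hn => ?_⟩
  have hcut := ((vanishesAtEnds_endCutoff _ n).bounded_mul hφ hM).continuousOn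
  have hprod : ContinuousOn (fun x => φ x * (endCutoff n x : ℂ) * g x) (spectrum ℝ S) :=
    hcut.mul hg.continuousOn
  rw [dist_eq_norm, ← boundedCalc_mul hS hcut hg.continuousOn,
    ← boundedCalc_sub hS hprod hφg.continuousOn]
  refine (norm_boundedCalc_le hS (by positivity : 0 ≤ ε / 2) fun x hx => ?_).trans_lt
    (half_lt_self hε)
  have hfac : φ x * (endCutoff n x : ℂ) * g x - φ x * g x =
      φ x * g x * ((endCutoff n x - 1 : ℝ) : ℂ) := by push_cast; ring
  rw [hfac, norm_mul, Complex.norm_real, Real.norm_eq_abs]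
  have h0 := endCutoff_nonneg n x
  have h1 := endCutoff_le_one n x
  rcases lt_or_ge (1 - x ^ 2) δ with hlt | hge
  · have h2 : |endCutoff n x - 1| ≤ 1 := abs_le.2 ⟨by linarith, by linarith⟩
    nlinarith [H x hx hlt, norm_nonneg (φ x * g x), abs_nonneg (endCutoff n x - 1)]
  · have h2 : endCutoff n x = 1 := by
      refine min_eq_left ?_
      have hn' : 1 / δ ≤ (n : ℝ) := hN.trans (by exact_mod_cast hn)
      rw [div_le_iff₀ hδ] at hn'
      rw [max_eq_right (hδ.le.trans hge)]
      exact hn'.trans (by gcongr)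
    rw [h2, sub_self, abs_zero, mul_zero]
    positivity

lemma spectrum_subset_Icc {S R : H →L[ℂ] H} (hS : IsSelfAdjoint S) (hR : IsSelfAdjoint R)
    (hSR : S * S = 1 - R * R) : spectrum ℝ S ⊆ Set.Icc (-1) 1 := by
  have hle : ‖S‖ ≤ 1 := by
    refine ContinuousLinearMap.opNorm_le_bound _ zero_le_one fun x => ?_
    rw [one_mul]
    have h1 : ⟪S x, S x⟫_ℂ = ⟪x, x⟫_ℂ - ⟪R x, R x⟫_ℂ := by
      have h2 : S (S x) = x - R (R x) := congrArg (fun A : H →L[ℂ] H => A x) hSR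
      rw [hS.isSymmetric.apply_clm x (S x), h2, inner_sub_right,
        hR.isSymmetric.apply_clm x (R x)]
    simp only [inner_self_eq_norm_sq_to_K] at h1
    have h2 : ‖S x‖ ^ 2 = ‖x‖ ^ 2 - ‖R x‖ ^ 2 := by exact_mod_cast h1
    exact le_of_sq_le_sq (by nlinarith [sq_nonneg ‖R x‖]) (norm_nonneg x)
  intro x hx
  have h1 := spectrum.norm_le_norm_mul_of_mem hx
  have h2 : ‖(1 : H →L[ℂ] H)‖ ≤ 1 := ContinuousLinearMap.norm_id_le
  rw [Real.norm_eq_abs] at h1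
  exact abs_le.1 (h1.trans (mul_le_one₀ hle (norm_nonneg _) h2))

lemma dense_c0Span {S R : H →L[ℂ] H} (hS : IsSelfAdjoint S) (hR : IsSelfAdjoint R)
    (hRinj : ∀ x, R x = 0 → x = 0) (hSR : S * S = 1 - R * R) :
    Dense ((c0Span S : Submodule ℂ H) : Set H) := by
  classical
  let g : ℝ → ℂ := fun x => if x ∈ tildeSpec S then ((1 - x ^ 2 : ℝ) : ℂ) else 0
  have hg : MemC0 g (tildeSpec S) := by
    refine ⟨?_, fun x hx => if_neg hx, fun ε hε => ?_⟩
    · have hc : ContinuousOn (fun x : ℝ => ((1 - x ^ 2 : ℝ) : ℂ)) (tildeSpec S) := by fun_prop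
      exact hc.congr fun x hx => if_pos hx
    · refine ⟨spectrum ℝ S ∩ {x | ε ≤ 1 - x ^ 2}, ?_, ?_, ?_⟩
      · exact (spectrum.isCompact S).inter_right (isClosed_le (by fun_prop) (by fun_prop))
      · exact fun x hx => ⟨hx.1, one_sub_sq_pos_iff.1 (hε.trans_le hx.2)⟩
      · intro x hx
        have h1 : 1 - x ^ 2 < ε := not_le.1 fun h => hx.2 ⟨hx.1.1, h⟩
        rw [show g x = _ from if_pos hx.1, Complex.norm_real, Real.norm_of_nonneg]
        exacts [h1, (one_sub_sq_pos_iff.2 hx.1.2).le]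
  have hgS : boundedCalc S g = R * R := by
    have h1 : boundedCalc S g = cfc (fun z : ℂ => 1 - z * z) S := by
      refine cfc_congr fun z hz => ?_
      have hz' := re_mem_spectrum hS hz
      have hzre := hS.mem_spectrum_eq_re hz
      have h2 : ((1 - z.re ^ 2 : ℝ) : ℂ) = 1 - z * z := by
        conv_rhs => rw [hzre]
        push_cast; ring
      rw [← h2]
      by_cases h3 : z.re ∈ Set.Ioo (-1 : ℝ) 1
      · exact if_pos ⟨hz', h3⟩
      · have h4 : 1 - z.re ^ 2 ≤ 0 := not_lt.1 fun h => h3 (one_sub_sq_pos_iff.1 h)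
        have h5 := spectrum_subset_Icc hS hR hSR hz'
        have h6 : 1 - z.re ^ 2 = 0 := by nlinarith [h5.1, h5.2]
        rw [h6, Complex.ofReal_zero]
        exact if_neg fun h => h3 h.2
    have hn : IsStarNormal S := hS.isStarNormal
    rw [h1, cfc_sub (fun _ : ℂ => 1) (fun z : ℂ => z * z) S, cfc_mul (fun z : ℂ => z)
      (fun z : ℂ => z) S, cfc_id' ℂ S, cfc_const_one ℂ S, hSR, sub_sub_cancel]
  rw [Submodule.dense_iff_topologicalClosure_eq_top, Submodule.topologicalClosure_eq_top_iff,
    Submodule.eq_bot_iff]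
  intro v hv
  have hmem : R (R v) ∈ c0Span S :=
    Submodule.subset_span ⟨g, hg, v, by rw [hgS]; rfl⟩
  have h1 := (Submodule.mem_orthogonal _ _).1 hv _ hmem
  rw [hR.isSymmetric.apply_clm (R v) v, inner_self_eq_zero] at h1
  exact hRinj v h1

/-- For `f ∈ C_b(σ(T))`, the operator `f₀(T)` on the dense domain `C*₀(S)H`, determined by
`f₀(T) h(T)ψ = (fh)(T)ψ` for `h ∈ C₀(σ(T))`, is well defined and bounded with
`‖f₀(T)‖ ≤ ‖f‖_∞`. -/
theorem f0T_wellDefined_bounded (T : H →ₗ.[ℂ] H) (S : H →L[ℂ] H)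
    (hdense : Dense (T.domain : Set H)) (hsa : IsSelfAdjoint T)
    (hbt : IsBoundedTransform T S) (f : ℝ → ℂ) (hf : MemCb f (realSpec T)) :
    Dense ((c0Span S : Submodule ℂ H) : Set H) ∧
    ∃ F : (c0Span S) →ₗ[ℂ] H,
      (∀ h : ℝ → ℂ, MemC0 h (realSpec T) → ∀ ψ : H,
        ∀ hm : pmapCalc S h ψ ∈ c0Span S,
          F ⟨pmapCalc S h ψ, hm⟩ = pmapCalc S (fun x => f x * h x) ψ) ∧
      (∀ v : c0Span S, ‖F v‖ ≤ supNorm f (realSpec T) * ‖(v : H)‖) := by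
  obtain ⟨hS, R, hR, hRinj, hSR, hgraph⟩ := hbt.exists_sqrt hdense hsa
  have hu : Set.MapsTo uFun (spectrum ℝ S ∩ Set.Ioo (-1) 1) (realSpec T) :=
    fun x hx => uFun_mem_realSpec hS hR hSR hgraph hx
  have hφ : ContinuousOn (compU f) (tildeSpec S) := continuousOn_compU hf.1 hu
  have hsup : 0 ≤ supNorm f (realSpec T) := by
    refine Real.sSup_nonneg ?_
    rintro _ ⟨y, -, rfl⟩
    exact norm_nonneg _
  have hM : ∀ x ∈ spectrum ℝ S, ‖compU f x‖ ≤ supNorm f (realSpec T) := by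
    intro x hx
    by_cases hx1 : x ∈ Set.Ioo (-1 : ℝ) 1
    · rw [compU, if_pos hx1]
      obtain ⟨M, hfM⟩ := hf.2
      refine le_csSup ⟨M, ?_⟩ ⟨uFun x, hu ⟨hx, hx1⟩, rfl⟩
      rintro _ ⟨y, hy, rfl⟩
      exact hfM y hy
    · rwa [compU, if_neg hx1, norm_zero]
  let A : ℕ → H →L[ℂ] H := fun n => boundedCalc S fun x => compU f x * endCutoff n x
  have hA : ∀ n, ‖A n‖ ≤ supNorm f (realSpec T) := fun n =>
    norm_boundedCalc_le hS hsup fun x hx => by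
      rw [norm_mul, norm_endCutoff]
      exact (mul_le_of_le_one_right (norm_nonneg _) (endCutoff_le_one n x)).trans (hM x hx)
  have hlim : ∀ g, VanishesAtEnds (spectrum ℝ S) g → ∀ ψ, Tendsto
      (fun n => A n (boundedCalc S g ψ)) atTop (𝓝 (boundedCalc S (fun x => compU f x * g x) ψ)) :=
    fun g hg ψ => ((ContinuousLinearMap.apply ℂ H ψ).continuous.tendsto _).comp
      (tendsto_boundedCalc_endCutoff hS hφ hM hg)
  have hex : ∀ v : c0Span S, ∃ w, Tendsto (fun n => A n v) atTop (𝓝 w) := by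
    rintro ⟨v, hv⟩
    induction hv using Submodule.span_induction with
    | mem v hv =>
      obtain ⟨g, hg, ψ, rfl⟩ := hv
      exact ⟨_, hlim g hg.vanishesAtEnds ψ⟩
    | zero => exact ⟨0, by simp⟩
    | add v w _ _ hv hw =>
      obtain ⟨a, ha⟩ := hv
      obtain ⟨b, hb⟩ := hw
      exact ⟨a + b, by simpa using ha.add hb⟩
    | smul c v _ hv =>
      obtain ⟨a, ha⟩ := hv
      exact ⟨c • a, by simpa using ha.const_smul c⟩
  choose F hF using hex
  refine ⟨dense_c0Span hS hR.isSelfAdjoint hRinj hSR,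
    linearMapOfTendsto F (fun n => (A n : H →ₗ[ℂ] H).comp (c0Span S).subtype)
      (tendsto_pi_nhds.2 hF), fun h hh ψ hm => ?_, fun v => ?_⟩
  · have h1 := hlim _ (hh.vanishesAtEnds_compU hu) ψ
    have h2 : (fun x => compU f x * compU h x) = compU fun x => f x * h x := by
      ext x
      by_cases hx : x ∈ Set.Ioo (-1 : ℝ) 1 <;> simp only [compU, hx, if_true, if_false, mul_zero]
    rw [h2] at h1
    exact tendsto_nhds_unique (hF ⟨_, hm⟩) h1
  · refine le_of_tendsto (hF v).norm (Eventually.of_forall fun n => ?_)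
    exact (A n).le_of_opNorm_le (hA n) v
end
end
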